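/- Let J be the standard matrix and χ the standard bi-hinge determined by dimension data (α_i^j). Suppose (g,h) ∈ ∏_{i=1}^p GL(α_i,k) × ∏_{j=1}^q GL(β_j,k) stabilizes χ, i.e., {(g_i x, h_j y) : (x,y) ∈ χ_ij} = χ_ij for all i, j. Let G ∈ GL(n,k) be the block diagonal matrix with blocks g_1,...,g_p (V-decomposition) and H ∈ GL(n,k) the block diagonal matrix with blocks h_1,...,h_q (W-decomposition). Then H·J·G^{−1} lies in the double coset T_-(β_1,...,β_q)·J·T_+(α_1,...,α_p); i.e., any element stabilizing the standard bi-hinge stabilizes the double coset of J. (Lemma 2.4.) -/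

import Mathlib

namespace Neretin

open scoped BigOperators

variable {k : Type*} [Field k]

/-- Offset of the `i`-th block of the partition `α`. -/
def off {p : ℕ} (α : Fin p → ℕ) (i : Fin p) : ℕ := ∑ i' ∈ Finset.Iio i, α i'

theorem coord_lt {p n : ℕ} {α : Fin p → ℕ} (hα : ∑ i, α i = n) (i : Fin p)
    (t : Fin (α i)) : off α i + (t : ℕ) < n := by
  have h1 : off α i + α i ≤ n := by
    rw [← hα]
    have h2 : insert i (Finset.Iio i) = Finset.Iic i := Finset.Iio_insert i
    have h3 : off α i + α i = ∑ i' ∈ Finset.Iic i, α i' := by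
      rw [← h2, Finset.sum_insert (by simp)]
      unfold off
      omega
    rw [h3]
    exact Finset.sum_le_sum_of_subset (Finset.subset_univ _)
  have h4 := t.isLt
  omega

/-- The coordinate of `k^n` corresponding to the `t`-th coordinate of the `i`-th block. -/
def coord {p n : ℕ} {α : Fin p → ℕ} (hα : ∑ i, α i = n) (i : Fin p) (t : Fin (α i)) : Fin n :=
  ⟨off α i + (t : ℕ), coord_lt hα i t⟩

/-- Subspace of vectors vanishing at all coordinates satisfying `P`. -/
def vanishOn {ι : Type*} (P : ι → Prop) : Submodule k (ι → k) :=
  ⨅ r ∈ {r : ι | P r}, LinearMap.ker (LinearMap.proj (R := k) (φ := fun _ : ι => k) r)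

/-- The linear relation `χ_ij(A) : V_i ⇉ W_j`. -/
def chi {p q n : ℕ} (α : Fin p → ℕ) (β : Fin q → ℕ) (hα : ∑ i, α i = n) (hβ : ∑ j, β j = n)
    (A : Matrix (Fin n) (Fin n) k) (i : Fin p) (j : Fin q) :
    Submodule k ((Fin (α i) → k) × (Fin (β j) → k)) :=
  Submodule.map
    ((LinearMap.funLeft k k (coord hα i)).prod
      ((LinearMap.funLeft k k (coord hβ j)).comp (Matrix.mulVecLin A)))
    (vanishOn (fun r : Fin n => off α i + α i ≤ (r : ℕ)) ⊓
      Submodule.comap (Matrix.mulVecLin A) (vanishOn fun r : Fin n => (r : ℕ) < off β j))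

section Rel

variable {X Y : Type*} [AddCommGroup X] [Module k X] [AddCommGroup Y] [Module k Y]

/-- Kernel of a linear relation. -/
def rker (L : Submodule k (X × Y)) : Submodule k X := Submodule.comap (LinearMap.inl k X Y) L

/-- Domain of a linear relation. -/
def rdom (L : Submodule k (X × Y)) : Submodule k X := Submodule.map (LinearMap.fst k X Y) L

/-- Image of a linear relation. -/
def rim (L : Submodule k (X × Y)) : Submodule k Y := Submodule.map (LinearMap.snd k X Y) L

/-- Indefiniteness of a linear relation. -/
def rindef (L : Submodule k (X × Y)) : Submodule k Y := Submodule.comap (LinearMap.inr k X Y) L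

end Rel

/-- `blockLT α a b`: coordinate `a` lies in a strictly earlier block than `b`. -/
def blockLT {p : ℕ} (α : Fin p → ℕ) (a b : ℕ) : Prop :=
  ∃ i : Fin p, off α i ≤ b ∧ a < off α i

/-- `sameBlock α a b` : coordinates `a`, `b` lie in the same block. -/
def sameBlock {p : ℕ} (α : Fin p → ℕ) (a b : ℕ) : Prop :=
  ∀ i : Fin p, off α i ≤ a ↔ off α i ≤ b

/-- Block upper triangular matrices (the group `P_+`). -/
def IsPPlus {n p : ℕ} (α : Fin p → ℕ) (g : Matrix (Fin n) (Fin n) k) : Prop :=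
  ∀ r s : Fin n, blockLT α (s : ℕ) (r : ℕ) → g r s = 0

/-- Block lower triangular matrices (the group `P_-`). -/
def IsPMinus {n p : ℕ} (α : Fin p → ℕ) (g : Matrix (Fin n) (Fin n) k) : Prop :=
  ∀ r s : Fin n, blockLT α (r : ℕ) (s : ℕ) → g r s = 0

/-- Block strictly upper triangular matrices (the group `T_+`). -/
def IsTPlus {n p : ℕ} (α : Fin p → ℕ) (g : Matrix (Fin n) (Fin n) k) : Prop :=
  IsPPlus α g ∧ ∀ r s : Fin n, sameBlock α (r : ℕ) (s : ℕ) → g r s = if r = s then 1 else 0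

/-- Block strictly lower triangular matrices (the group `T_-`). -/
def IsTMinus {n p : ℕ} (α : Fin p → ℕ) (g : Matrix (Fin n) (Fin n) k) : Prop :=
  IsPMinus α g ∧ ∀ r s : Fin n, sameBlock α (r : ℕ) (s : ℕ) → g r s = if r = s then 1 else 0

/-- Bi-hinges. -/
def IsBiHinge {p q : ℕ} (α : Fin p → ℕ) (β : Fin q → ℕ)
    (ξ : (i : Fin p) → (j : Fin q) → Submodule k ((Fin (α i) → k) × (Fin (β j) → k))) : Prop :=
  (∀ (i : Fin p) (j j' : Fin q), (j' : ℕ) = (j : ℕ) + 1 → rker (ξ i j) = rdom (ξ i j')) ∧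
  (∀ (i i' : Fin p) (j : Fin q), (i' : ℕ) = (i : ℕ) + 1 → rim (ξ i j) = rindef (ξ i' j)) ∧
  (∀ (i : Fin p) (j : Fin q), (i : ℕ) = 0 → rindef (ξ i j) = ⊥) ∧
  (∀ (i : Fin p) (j : Fin q), (i : ℕ) + 1 = p → rim (ξ i j) = ⊤) ∧
  (∀ (i : Fin p) (j : Fin q), (j : ℕ) + 1 = q → rker (ξ i j) = ⊥) ∧
  (∀ (i : Fin p) (j : Fin q), (j : ℕ) = 0 → rdom (ξ i j) = ⊤)

/-- 0-1 matrices with exactly one unit in each row and each column. -/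
def IsPermMatrix {n : ℕ} (M : Matrix (Fin n) (Fin n) k) : Prop :=
  ∃ σ : Equiv.Perm (Fin n), ∀ r s, M r s = if r = σ s then 1 else 0

/-- Offset of the sub-block `V_i^j` inside `V_i`. -/
def offA {p q : ℕ} (a : Fin p → Fin q → ℕ) (i : Fin p) (j : Fin q) : ℕ :=
  ∑ j' ∈ Finset.Iio j, a i j'

/-- Offset of the sub-block `W_j^i` inside `W_j`. -/
def offB {p q : ℕ} (a : Fin p → Fin q → ℕ) (i : Fin p) (j : Fin q) : ℕ :=
  ∑ i' ∈ Finset.Iio i, a i' j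

open Classical in
/-- The standard 0-1 matrix determined by the dimension data `a`. -/
noncomputable def stdMatrix {p q : ℕ} (n : ℕ) (α : Fin p → ℕ) (β : Fin q → ℕ)
    (a : Fin p → Fin q → ℕ) : Matrix (Fin n) (Fin n) k :=
  Matrix.of fun r s : Fin n =>
    if ∃ (i : Fin p) (j : Fin q) (t : ℕ), t < a i j ∧
        (s : ℕ) = off α i + offA a i j + t ∧ (r : ℕ) = off β j + offB a i j + t
      then (1 : k) else 0

/-- The standard bi-hinge determined by the dimension data `a`. -/
def stdHinge {p q : ℕ} (α : Fin p → ℕ) (β : Fin q → ℕ) (a : Fin p → Fin q → ℕ)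
    (i : Fin p) (j : Fin q) : Submodule k ((Fin (α i) → k) × (Fin (β j) → k)) where
  carrier := {z | (∀ u : Fin (α i), (u : ℕ) < offA a i j → z.1 u = 0) ∧
    (∀ v : Fin (β j), offB a i j + a i j ≤ (v : ℕ) → z.2 v = 0) ∧
    ∀ (u : Fin (α i)) (v : Fin (β j)) (t : ℕ), t < a i j →
      (u : ℕ) = offA a i j + t → (v : ℕ) = offB a i j + t → z.1 u = z.2 v}
  add_mem' := by
    rintro x y ⟨hx1, hx2, hx3⟩ ⟨hy1, hy2, hy3⟩
    refine ⟨fun u hu => ?_, fun v hv => ?_, fun u v t ht hu hv => ?_⟩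
    · show x.1 u + y.1 u = 0
      rw [hx1 u hu, hy1 u hu, add_zero]
    · show x.2 v + y.2 v = 0
      rw [hx2 v hv, hy2 v hv, add_zero]
    · show x.1 u + y.1 u = x.2 v + y.2 v
      rw [hx3 u v t ht hu hv, hy3 u v t ht hu hv]
  zero_mem' := ⟨fun _ _ => rfl, fun _ _ => rfl, fun _ _ _ _ _ _ => rfl⟩
  smul_mem' := by
    rintro c x ⟨hx1, hx2, hx3⟩
    refine ⟨fun u hu => ?_, fun v hv => ?_, fun u v t ht hu hv => ?_⟩
    · show c * x.1 u = 0
      rw [hx1 u hu, mul_zero]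
    · show c * x.2 v = 0
      rw [hx2 v hv, mul_zero]
    · show c * x.1 u = c * x.2 v
      rw [hx3 u v t ht hu hv]

/-- A nonzero entry of a product comes from a path of nonzero entries. -/
theorem exists_ne_zero_of_mul_ne_zero {T : Type*} [Fintype T] {M N : Matrix T T k} {x y : T}
    (hxy : (M * N) x y ≠ 0) : ∃ z, M x z ≠ 0 ∧ N z y ≠ 0 := by
  rw [Matrix.mul_apply] at hxy
  obtain ⟨z, -, hz⟩ := Finset.exists_ne_zero_of_sum_ne_zero hxy
  exact ⟨z, left_ne_zero_of_mul hz, right_ne_zero_of_mul hz⟩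

/-- The right inverse of a block triangular matrix is block triangular. -/
theorem le_of_right_inverse_ne_zero {T ι : Type*} [Fintype T] [DecidableEq T] [LinearOrder ι]
    {M N : Matrix T T k} (hMN : M * N = 1) {b : T → ι} (hM : ∀ x y, M x y ≠ 0 → b x ≤ b y)
    (x y : T) (hxy : N x y ≠ 0) : b x ≤ b y := by
  let _ : Invertible M := ⟨N, mul_eq_one_comm.1 hMN, hMN⟩
  have hb : M.BlockTriangular b := fun x y hlt => by
    by_contra hne
    exact absurd (hM x y hne) (not_le.2 hlt)
  have hinv := Matrix.blockTriangular_inv_of_blockTriangular hb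
  rw [Matrix.inv_eq_right_inv hMN] at hinv
  by_contra hlt
  exact hxy (hinv (not_le.1 hlt))

/-- If `G` preserves the first grading and is lower triangular for the second one, `H` preserves the
second grading and is upper triangular for the first one, and their bigraded diagonal parts agree,
then `H * G⁻¹` is a product of a lower unitriangular matrix for the second grading and an upper
unitriangular matrix for the first grading. -/
theorem exists_unitriangular_factorization {T ι κ : Type*} [Fintype T] [DecidableEq T]
    [LinearOrder ι] [LinearOrder κ] (I : T → ι) (J : T → κ) {G G' H H' : Matrix T T k}
    (hGG' : G * G' = 1) (hHH' : H * H' = 1)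
    (hG : ∀ x y, G x y ≠ 0 → I x = I y ∧ J y ≤ J x)
    (hH : ∀ x y, H x y ≠ 0 → J x = J y ∧ I x ≤ I y)
    (hdiag : ∀ x y, I x = I y → J x = J y → G x y = H x y) :
    ∃ B C : Matrix T T k, (∀ x y, (B - 1) x y ≠ 0 → J y < J x) ∧
      (∀ x y, (C - 1) x y ≠ 0 → I x < I y) ∧ H * G' = B * C := by
  have hG' : ∀ x y, G' x y ≠ 0 → I x = I y ∧ J y ≤ J x := fun x y hxy =>
    ⟨le_antisymm (le_of_right_inverse_ne_zero hGG' (b := I) (fun x y h => (hG x y h).1.le) x y hxy)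
      (le_of_right_inverse_ne_zero hGG' (b := OrderDual.toDual ∘ I)
        (fun x y h => (hG x y h).1.ge) x y hxy),
      le_of_right_inverse_ne_zero hGG' (b := OrderDual.toDual ∘ J)
        (fun x y h => (hG x y h).2) x y hxy⟩
  have hH' : ∀ x y, H' x y ≠ 0 → J x = J y := fun x y hxy =>
    le_antisymm (le_of_right_inverse_ne_zero hHH' (b := J) (fun x y h => (hH x y h).1.le) x y hxy)
      (le_of_right_inverse_ne_zero hHH' (b := OrderDual.toDual ∘ J)
        (fun x y h => (hH x y h).1.ge) x y hxy)
  let D : Matrix T T k := Matrix.of fun x y => if I x = I y ∧ J x = J y then G x y else 0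
  let D' : Matrix T T k := Matrix.of fun x y => if I x = I y ∧ J x = J y then G' x y else 0
  have hD : ∀ x y, D x y ≠ 0 → I x = I y ∧ J x = J y := fun x y hxy => by
    by_contra hne
    exact hxy (if_neg hne)
  have hD' : ∀ x y, D' x y ≠ 0 → I x = I y ∧ J x = J y := fun x y hxy => by
    by_contra hne
    exact hxy (if_neg hne)
  have hDD' : D * D' = 1 := by
    ext x y
    by_cases hc : I x = I y ∧ J x = J y
    · rw [← hGG', Matrix.mul_apply, Matrix.mul_apply]
      refine Finset.sum_congr rfl fun z _ => ?_
      by_cases hz : I x = I z ∧ J x = J z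
      · have h1 : D x z = G x z := if_pos hz
        have h2 : D' z y = G' z y := if_pos ⟨hz.1 ▸ hc.1, hz.2 ▸ hc.2⟩
        rw [h1, h2]
      · have h1 : D x z = 0 := if_neg hz
        rw [h1, zero_mul]
        by_contra hne
        have h2 := hG x z (left_ne_zero_of_mul (Ne.symm hne))
        have h3 := hG' z y (right_ne_zero_of_mul (Ne.symm hne))
        exact hz ⟨h2.1, le_antisymm (hc.2 ▸ h3.2) h2.2⟩
    · rw [Matrix.one_apply_ne (by rintro rfl; exact hc ⟨rfl, rfl⟩)]
      by_contra hne
      obtain ⟨z, h1, h2⟩ := exists_ne_zero_of_mul_ne_zero hne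
      exact hc ⟨(hD x z h1).1.trans (hD' z y h2).1, (hD x z h1).2.trans (hD' z y h2).2⟩
  have hD'D : D' * D = 1 := mul_eq_one_comm.1 hDD'
  have hH'H : H' * H = 1 := mul_eq_one_comm.1 hHH'
  refine ⟨H * (G' * D) * H', H * D', fun x y hxy => ?_, fun x y hxy => ?_, ?_⟩
  · have hB : H * (G' * D) * H' - 1 = H * ((G' - D') * D) * H' := by
      rw [Matrix.sub_mul, hD'D, Matrix.mul_sub, Matrix.sub_mul, Matrix.mul_one, hHH']
    rw [hB] at hxy
    obtain ⟨w, h1, hwy⟩ := exists_ne_zero_of_mul_ne_zero hxy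
    obtain ⟨z, hxz, h2⟩ := exists_ne_zero_of_mul_ne_zero h1
    obtain ⟨v, hzv, hvw⟩ := exists_ne_zero_of_mul_ne_zero h2
    have hlt : J v < J z := by
      by_contra hnot
      refine hzv ?_
      rw [Matrix.sub_apply, sub_eq_zero]
      by_cases hc : I z = I v ∧ J z = J v
      · exact (if_pos hc).symm
      · have h3 : D' z v = 0 := if_neg hc
        rw [h3]
        by_contra hne
        have h4 := hG' z v hne
        exact hc ⟨h4.1, le_antisymm (not_lt.1 hnot) h4.2⟩
    rw [(hH x z hxz).1, ← hH' w y hwy, ← (hD v w hvw).2]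
    exact hlt
  · have hC : H * D' - 1 = (H - D) * D' := by rw [Matrix.sub_mul, hDD']
    rw [hC] at hxy
    obtain ⟨z, hxz, hzy⟩ := exists_ne_zero_of_mul_ne_zero hxy
    rw [← (hD' z y hzy).1]
    by_contra hnot
    refine hxz ?_
    rw [Matrix.sub_apply, sub_eq_zero]
    by_cases hc : I x = I z ∧ J x = J z
    · exact (hdiag x z hc.1 hc.2).symm.trans (if_pos hc).symm
    · have h3 : D x z = 0 := if_neg hc
      rw [h3]
      by_contra hne
      have h4 := hH x z hne
      exact hc ⟨le_antisymm h4.2 (not_lt.1 hnot), h4.1⟩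
  · calc H * G' = H * G' * (D * (H' * H) * D') := by
          rw [hH'H, Matrix.mul_one, hDD', Matrix.mul_one]
      _ = H * (G' * D) * H' * (H * D') := by simp only [Matrix.mul_assoc]

theorem off_add_le {p : ℕ} (α : Fin p → ℕ) {i i' : Fin p} (hi : i < i') :
    off α i + α i ≤ off α i' := by
  have h1 : off α i + α i = ∑ l ∈ insert i (Finset.Iio i), α l := by
    rw [Finset.sum_insert (by simp), add_comm, off]
  rw [h1, off]
  refine Finset.sum_le_sum_of_subset fun l hl => ?_
  rw [Finset.Iio_insert, Finset.mem_Iic] at hl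
  exact Finset.mem_Iio.2 (hl.trans_lt hi)

theorem off_le_coord_iff {p n : ℕ} {α : Fin p → ℕ} (hα : ∑ i, α i = n) (i' i : Fin p)
    (t : Fin (α i)) : off α i' ≤ (coord hα i t : ℕ) ↔ i' ≤ i := by
  have ht := t.isLt
  show off α i' ≤ off α i + t ↔ i' ≤ i
  refine ⟨fun hle => ?_, fun hle => ?_⟩
  · by_contra hlt
    have := off_add_le α (not_le.1 hlt)
    omega
  · rcases hle.eq_or_lt with rfl | hlt
    · omega
    · have := off_add_le α hlt
      omega

theorem sameBlock_coord_iff {p n : ℕ} {α : Fin p → ℕ} (hα : ∑ i, α i = n) {i i' : Fin p}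
    (t : Fin (α i)) (t' : Fin (α i')) :
    sameBlock α (coord hα i t) (coord hα i' t') ↔ i = i' := by
  simp only [sameBlock, off_le_coord_iff]
  exact ⟨fun hs => le_antisymm ((hs i).1 le_rfl) ((hs i').2 le_rfl), fun hs l => hs ▸ Iff.rfl⟩

theorem blockLT_coord_iff {p n : ℕ} {α : Fin p → ℕ} (hα : ∑ i, α i = n) {i i' : Fin p}
    (t : Fin (α i)) (t' : Fin (α i')) :
    blockLT α (coord hα i t) (coord hα i' t') ↔ i < i' := by
  simp only [blockLT, off_le_coord_iff, ← not_le]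
  exact ⟨fun ⟨l, h1, h2⟩ h3 => h2 (h1.trans h3), fun hlt => ⟨i', le_rfl, hlt⟩⟩

theorem coord_fst_eq {p n : ℕ} {α : Fin p → ℕ} (hα : ∑ i, α i = n) {i i' : Fin p}
    {t : Fin (α i)} {t' : Fin (α i')}
    (he : coord hα i t = coord hα i' t') : i = i' := by
  rw [← sameBlock_coord_iff hα t t', he]
  exact fun _ => Iff.rfl

theorem coord_injective {p n : ℕ} {α : Fin p → ℕ} (hα : ∑ i, α i = n) (i : Fin p) :
    Function.Injective (coord hα i) := fun t t' he =>
  Fin.ext (Nat.add_left_cancel (congrArg Fin.val he))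

/-- The indexing of all coordinates by a pair of blocks and a position in `V_i^j`. -/
abbrev Cell {p q : ℕ} (a : Fin p → Fin q → ℕ) : Type :=
  Σ x : Fin p × Fin q, Fin (a x.1 x.2)

section Cell

variable {p q n : ℕ} {α : Fin p → ℕ} {β : Fin q → ℕ} {a : Fin p → Fin q → ℕ}

/-- The coordinate of `V` at a given cell. -/
def cellV (hα : ∑ i, α i = n) (hrow : ∀ i, ∑ j, a i j = α i) (x : Cell a) : Fin n :=
  coord hα x.1.1 (coord (hrow x.1.1) x.1.2 x.2)

/-- The coordinate of `W` at a given cell. -/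
def cellW (hβ : ∑ j, β j = n) (hcol : ∀ j, ∑ i, a i j = β j) (x : Cell a) : Fin n :=
  coord hβ x.1.2 (coord (α := fun i => a i x.1.2) (hcol x.1.2) x.1.1 x.2)

theorem cellV_bijective (hα : ∑ i, α i = n) (hrow : ∀ i, ∑ j, a i j = α i) :
    Function.Bijective (cellV hα hrow) := by
  refine (Fintype.bijective_iff_injective_and_card _).2 ⟨?_, ?_⟩
  · rintro ⟨⟨i, j⟩, t⟩ ⟨⟨i', j'⟩, t'⟩ he
    obtain rfl : i = i' := coord_fst_eq hα he
    have he' := coord_injective hα i he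
    obtain rfl : j = j' := coord_fst_eq (hrow i) he'
    obtain rfl : t = t' := coord_injective (hrow i) j he'
    rfl
  · simp [Fintype.sum_prod_type, hrow, hα]

theorem cellW_bijective (hβ : ∑ j, β j = n) (hcol : ∀ j, ∑ i, a i j = β j) :
    Function.Bijective (cellW hβ hcol) := by
  refine (Fintype.bijective_iff_injective_and_card _).2 ⟨?_, ?_⟩
  · rintro ⟨⟨i, j⟩, t⟩ ⟨⟨i', j'⟩, t'⟩ he
    obtain rfl : j = j' := coord_fst_eq hβ he
    have he' := coord_injective hβ j he
    obtain rfl : i = i' := coord_fst_eq (hcol j) he'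
    obtain rfl : t = t' := coord_injective (α := fun i => a i j) (hcol j) i he'
    rfl
  · simp [Fintype.sum_prod_type_right, hcol, hβ]

/-- In cell coordinates, the standard matrix is the identity. -/
theorem stdMatrix_cell (hα : ∑ i, α i = n) (hβ : ∑ j, β j = n)
    (hrow : ∀ i, ∑ j, a i j = α i) (hcol : ∀ j, ∑ i, a i j = β j) (x y : Cell a) :
    stdMatrix (k := k) n α β a (cellW hβ hcol x) (cellV hα hrow y) =
      (1 : Matrix (Cell a) (Cell a) k) x y := by
  rw [stdMatrix, Matrix.of_apply, Matrix.one_apply]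
  refine if_congr ⟨?_, ?_⟩ rfl rfl
  · rintro ⟨i, j, t, ht, hV, hW⟩
    have h1 : y = ⟨(i, j), ⟨t, ht⟩⟩ :=
      (cellV_bijective hα hrow).1 (Fin.ext (hV.trans (add_assoc _ _ _)))
    have h2 : x = ⟨(i, j), ⟨t, ht⟩⟩ :=
      (cellW_bijective hβ hcol).1 (Fin.ext (hW.trans (add_assoc _ _ _)))
    rw [h1, h2]
  · rintro rfl
    exact ⟨x.1.1, x.1.2, x.2, x.2.isLt, (add_assoc _ _ _).symm, (add_assoc _ _ _).symm⟩

/-- The pair of basis vectors at a cell belongs to the standard bi-hinge. -/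
theorem single_mem_stdHinge (hrow : ∀ i, ∑ j, a i j = α i) (hcol : ∀ j, ∑ i, a i j = β j)
    (i : Fin p) (j : Fin q) (t : Fin (a i j)) :
    ((Pi.single (coord (hrow i) j t) 1, Pi.single (coord (α := fun i => a i j) (hcol j) i t) 1) :
      (Fin (α i) → k) × (Fin (β j) → k)) ∈ stdHinge α β a i j := by
  have hu : ((coord (hrow i) j t : Fin (α i)) : ℕ) = offA a i j + t := rfl
  have hv : ((coord (α := fun i => a i j) (hcol j) i t : Fin (β j)) : ℕ) = offB a i j + t := rfl
  have ht := t.isLt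
  refine ⟨fun u hlt => Pi.single_eq_of_ne (fun he => ?_) _,
    fun v hle => Pi.single_eq_of_ne (fun he => ?_) _, fun u v s hs hus hvs => ?_⟩
  · rw [he] at hlt
    omega
  · rw [he] at hle
    omega
  · simp only [Pi.single_apply, Fin.ext_iff, hu, hv, hus, hvs, Nat.add_left_cancel_iff]

/-- The columns of a pair stabilizing the standard bi-hinge. -/
theorem columns_mem_stdHinge (hrow : ∀ i, ∑ j, a i j = α i) (hcol : ∀ j, ∑ i, a i j = β j)
    {i : Fin p} {j : Fin q} {M : Matrix (Fin (α i)) (Fin (α i)) k}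
    {N : Matrix (Fin (β j)) (Fin (β j)) k}
    (hstab : Submodule.map (LinearMap.prodMap (Matrix.mulVecLin M) (Matrix.mulVecLin N))
      (stdHinge α β a i j) = stdHinge α β a i j) (t : Fin (a i j)) :
    ((fun u => M u (coord (hrow i) j t),
      fun v => N v (coord (α := fun i => a i j) (hcol j) i t)) :
      (Fin (α i) → k) × (Fin (β j) → k)) ∈ stdHinge α β a i j := by
  have hmem := Submodule.mem_map_of_mem
    (f := LinearMap.prodMap (Matrix.mulVecLin M) (Matrix.mulVecLin N))
    (single_mem_stdHinge (k := k) hrow hcol i j t)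
  rw [hstab] at hmem
  convert hmem using 1
  ext <;> simp

end Cell

theorem statement15 (p q n : ℕ) (hp : 0 < p) (hq : 0 < q)
    (α : Fin p → ℕ) (β : Fin q → ℕ)
    (hαpos : ∀ i, 0 < α i) (hβpos : ∀ j, 0 < β j)
    (hα : ∑ i, α i = n) (hβ : ∑ j, β j = n)
    (a : Fin p → Fin q → ℕ)
    (hrow : ∀ i, ∑ j, a i j = α i) (hcol : ∀ j, ∑ i, a i j = β j)
    (g : ∀ i, GL (Fin (α i)) k) (h : ∀ j, GL (Fin (β j)) k)
    (hstab : ∀ (i : Fin p) (j : Fin q),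
      Submodule.map
        (LinearMap.prodMap (Matrix.mulVecLin (g i).val) (Matrix.mulVecLin (h j).val))
        (stdHinge α β a i j) = stdHinge α β a i j)
    (G H : GL (Fin n) k)
    (hGblk : ∀ (i : Fin p) (t s : Fin (α i)),
      G.val (coord hα i t) (coord hα i s) = (g i).val t s)
    (hGoff : ∀ r s : Fin n, ¬ sameBlock α (r : ℕ) (s : ℕ) → G.val r s = 0)
    (hHblk : ∀ (j : Fin q) (t s : Fin (β j)),
      H.val (coord hβ j t) (coord hβ j s) = (h j).val t s)
    (hHoff : ∀ r s : Fin n, ¬ sameBlock β (r : ℕ) (s : ℕ) → H.val r s = 0) :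
    ∃ B C : Matrix (Fin n) (Fin n) k, IsTMinus β B ∧ IsTPlus α C ∧
      H.val * stdMatrix (k := k) n α β a * (G⁻¹).val =
        B * stdMatrix (k := k) n α β a * C := by
  let eV := Equiv.ofBijective _ (cellV_bijective hα hrow)
  let eW := Equiv.ofBijective _ (cellW_bijective hβ hcol)
  have hcols := fun i j => columns_mem_stdHinge hrow hcol (hstab i j)
  have hJ : stdMatrix (k := k) n α β a =
      (1 : Matrix (Cell a) (Cell a) k).submatrix eW.symm eV.symm := by
    ext r s
    obtain ⟨x, rfl⟩ := eW.surjective r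
    obtain ⟨y, rfl⟩ := eV.surjective s
    rw [Matrix.submatrix_apply, eW.symm_apply_apply, eV.symm_apply_apply]
    exact stdMatrix_cell hα hβ hrow hcol x y
  obtain ⟨B, C, hB, hC, hBC⟩ := exists_unitriangular_factorization
    (fun x : Cell a => x.1.1) (fun x : Cell a => x.1.2)
    (G := G.val.submatrix eV eV) (G' := (G⁻¹).val.submatrix eV eV)
    (H := H.val.submatrix eW eW) (H' := (H⁻¹).val.submatrix eW eW)
    (by rw [Matrix.submatrix_mul_equiv, Units.mul_inv, Matrix.submatrix_one_equiv])
    (by rw [Matrix.submatrix_mul_equiv, Units.mul_inv, Matrix.submatrix_one_equiv])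
    (by
      rintro ⟨⟨i, j⟩, t⟩ ⟨⟨i', j'⟩, t'⟩ hne
      obtain rfl : i = i' := by
        by_contra hi
        exact hne (hGoff _ _ fun hs => hi ((sameBlock_coord_iff hα _ _).1 hs))
      refine ⟨rfl, ?_⟩
      by_contra hlt
      refine hne ((hGblk _ _ _).trans ((hcols i j' t').1 _ ?_))
      have h1 := off_add_le (a i) (not_le.1 hlt)
      have h2 := t.isLt
      show off (a i) j + t < off (a i) j'
      dsimp only at h1 h2
      omega)
    (by
      rintro ⟨⟨i, j⟩, t⟩ ⟨⟨i', j'⟩, t'⟩ hne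
      obtain rfl : j = j' := by
        by_contra hj
        exact hne (hHoff _ _ fun hs => hj ((sameBlock_coord_iff hβ _ _).1 hs))
      refine ⟨rfl, ?_⟩
      by_contra hlt
      refine hne ((hHblk _ _ _).trans ((hcols i' j t').2.1 _ ?_))
      have h1 := off_add_le (fun i => a i j) (not_le.1 hlt)
      exact h1.trans (Nat.le_add_right _ _))
    (by
      rintro ⟨⟨i, j⟩, t⟩ ⟨⟨i', j'⟩, t'⟩ hi hj
      obtain rfl : i = i' := hi
      obtain rfl : j = j' := hj
      exact (hGblk _ _ _).trans
        (((hcols i j t').2.2 _ _ t t.isLt rfl rfl).trans (hHblk _ _ _).symm))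
  have hB' : ∀ x y : Cell a, ¬ y.1.2 < x.1.2 → B x y = (1 : Matrix _ _ k) x y :=
    fun x y hlt => by
      by_contra hne
      exact hlt (hB x y (sub_ne_zero.2 hne))
  have hC' : ∀ x y : Cell a, ¬ x.1.1 < y.1.1 → C x y = (1 : Matrix _ _ k) x y :=
    fun x y hlt => by
      by_contra hne
      exact hlt (hC x y (sub_ne_zero.2 hne))
  refine ⟨B.submatrix eW.symm eW.symm, C.submatrix eV.symm eV.symm, ⟨?_, ?_⟩, ⟨?_, ?_⟩, ?_⟩
  · intro r s hrs
    obtain ⟨x, rfl⟩ := eW.surjective r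
    obtain ⟨y, rfl⟩ := eW.surjective s
    have hlt : x.1.2 < y.1.2 := (blockLT_coord_iff hβ _ _).1 hrs
    rw [Matrix.submatrix_apply, eW.symm_apply_apply, eW.symm_apply_apply, hB' x y hlt.not_gt,
      Matrix.one_apply_ne (by rintro rfl; exact lt_irrefl _ hlt)]
  · intro r s hrs
    obtain ⟨x, rfl⟩ := eW.surjective r
    obtain ⟨y, rfl⟩ := eW.surjective s
    have heq : x.1.2 = y.1.2 := (sameBlock_coord_iff hβ _ _).1 hrs
    rw [Matrix.submatrix_apply, eW.symm_apply_apply, eW.symm_apply_apply, hB' x y heq.not_gt,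
      Matrix.one_apply]
    exact if_congr eW.injective.eq_iff.symm rfl rfl
  · intro r s hrs
    obtain ⟨x, rfl⟩ := eV.surjective r
    obtain ⟨y, rfl⟩ := eV.surjective s
    have hlt : y.1.1 < x.1.1 := (blockLT_coord_iff hα _ _).1 hrs
    rw [Matrix.submatrix_apply, eV.symm_apply_apply, eV.symm_apply_apply, hC' x y hlt.not_gt,
      Matrix.one_apply_ne (by rintro rfl; exact lt_irrefl _ hlt)]
  · intro r s hrs
    obtain ⟨x, rfl⟩ := eV.surjective r
    obtain ⟨y, rfl⟩ := eV.surjective s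
    have heq : x.1.1 = y.1.1 := (sameBlock_coord_iff hα _ _).1 hrs
    rw [Matrix.submatrix_apply, eV.symm_apply_apply, eV.symm_apply_apply, hC' x y heq.not_lt,
      Matrix.one_apply]
    exact if_congr eV.injective.eq_iff.symm rfl rfl
  · have hG : (G⁻¹).val = ((G⁻¹).val.submatrix eV eV).submatrix eV.symm eV.symm := by
      simp [Matrix.submatrix_submatrix]
    have hH : H.val = (H.val.submatrix eW eW).submatrix eW.symm eW.symm := by
      simp [Matrix.submatrix_submatrix]
    rw [hG, hH, hJ]
    simp only [Matrix.submatrix_mul_equiv, Matrix.mul_one]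
    rw [hBC]

end Neretin
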